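/- arXiv:2407.06876 — 2 statements merged into one kernel-verified Lean document; each statement's English description precedes it below -/
import Mathlib

section
/- Fix λ > 0, a point x₁ ∈ ℝ³, a unit vector e ∈ ℝ³, real numbers α₁, α₂ with α₁ + α₂ ≠ 0, set α = α₁α₂/(α₁+α₂) and assume α + √λ ≠ 0. Let θ : [0,∞) → ℝ be differentiable at 0 with θ(0) = 1 and θ'(0) = 0. For R > 0 put x₂(R) = x₁ + R e, δ(R) = δ_{λ,θ}(R), and D(R) = (α₁+√λ)(α₂+√λ) − δ(R)². For f ∈ L²(ℝ³;ℂ) define u_f(x) = (1/(4π)) ∫_{ℝ³} g^λ(x−y) f(y) dy (absolutely convergent since g^λ ∈ L²), and, whenever D(R) ≠ 0, q₁(R,f) = ((α₂+√λ) u_f(x₁) − δ(R) u_f(x₂(R)))/D(R) and q₂(R,f) = ((α₁+√λ) u_f(x₂(R)) − δ(R) u_f(x₁))/D(R). Then there exists R₀ > 0 with D(R) ≠ 0 for all 0 < R < R₀, and lim_{R→0⁺} sup_{‖f‖_{L²} ≤ 1} ‖ q₁(R,f) g^λ(·−x₁) + q₂(R,f) g^λ(·−x₂(R)) − (u_f(x₁)/(α+√λ))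 g^λ(·−x₁) ‖_{L²(ℝ³)} = 0. -/
open MeasureTheory Filter Topology

lemma memLp_g (s : ℝ) (hs : 0 < s) :
    MemLp (fun x : EuclideanSpace ℝ (Fin 3) => Complex.ofReal (Real.exp (-s * ‖x‖) / ‖x‖))
      2 volume := by
  have hm : Measurable (fun x : EuclideanSpace ℝ (Fin 3) =>
      Complex.ofReal (Real.exp (-s * ‖x‖) / ‖x‖)) := by
    fun_prop
  rw [memLp_two_iff_integrable_sq_norm hm.aestronglyMeasurable]
  have := (integrable_fun_norm_addHaar (volume : Measure (EuclideanSpace ℝ (Fin 3)))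
    (f := fun r : ℝ => ‖Complex.ofReal (Real.exp (-s * r) / r)‖ ^ 2))
  rw [this]
  have h2 : IntegrableOn (fun y : ℝ => Real.exp (-(2 * s) * y)) (Set.Ioi 0) :=
    integrableOn_exp_mul_Ioi (by linarith) 0
  refine h2.congr_fun ?_ measurableSet_Ioi
  intro y hy
  have hy' : (0:ℝ) < y := hy
  simp only [Complex.norm_real, Real.norm_eq_abs, sq_abs, finrank_euclideanSpace,
    Fintype.card_fin, smul_eq_mul]
  rw [div_pow, ← Real.exp_nat_mul]
  have : y ^ (3 - 1) = y ^ 2 := rfl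
  rw [this]
  field_simp
  congr 1
  push_cast
  ring

lemma tendsto_delta (s : ℝ) (θ : ℝ → ℝ) (hθ0 : θ 0 = 1)
    (hθ : HasDerivWithinAt θ 0 (Set.Ici 0) 0) :
    Tendsto (fun R => (θ R - Real.exp (-s * R)) / R) (𝓝[>] 0) (𝓝 s) := by
  have h1 : HasDerivAt (fun R : ℝ => Real.exp (-s * R)) (-s) 0 := by
    have := ((hasDerivAt_id (0:ℝ)).const_mul (-s)).exp
    simpa using this
  have h2 := (hθ.sub h1.hasDerivWithinAt).mono Set.Ioi_subset_Ici_self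
  rw [hasDerivWithinAt_iff_tendsto_slope' (by simp)] at h2
  refine Tendsto.congr (fun R => ?_) (by simpa using h2)
  simp [slope_def_field, hθ0]


/-- Norm-resolvent convergence, as the two centers merge, of the Hamiltonian with two
non-local point interactions of strengths `α₁, α₂` at `x₁` and `x₂(R) = x₁ + R e` to the
Hamiltonian with a single point interaction at `x₁` of strength `α`, where
`1/α = 1/α₁ + 1/α₂`: the supremum over `‖f‖_{L²} ≤ 1` of the `L²` norm of the difference
of the singular parts of the resolvents tends to `0` as `R → 0⁺`. -/
theorem stmt_18 (lam : ℝ) (hlam : 0 < lam)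
    (x₁ e : EuclideanSpace ℝ (Fin 3)) (he : ‖e‖ = 1)
    (α₁ α₂ : ℝ) (hsum : α₁ + α₂ ≠ 0)
    (α : ℝ) (hα : α = α₁ * α₂ / (α₁ + α₂)) (hden : α + Real.sqrt lam ≠ 0)
    (θ : ℝ → ℝ) (hθ0 : θ 0 = 1) (hθ : HasDerivWithinAt θ 0 (Set.Ici 0) 0)
    (g : EuclideanSpace ℝ (Fin 3) → ℝ)
    (hg : ∀ x, g x = Real.exp (-Real.sqrt lam * ‖x‖) / ‖x‖)
    (δ D : ℝ → ℝ)
    (hδ : ∀ R, δ R = (θ R - Real.exp (-Real.sqrt lam * R)) / R)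
    (hD : ∀ R, D R = (α₁ + Real.sqrt lam) * (α₂ + Real.sqrt lam) - δ R ^ 2)
    (uf : Lp ℂ 2 (volume : Measure (EuclideanSpace ℝ (Fin 3))) →
      EuclideanSpace ℝ (Fin 3) → ℂ)
    (huf : ∀ f x, uf f x = (1 / (4 * Real.pi)) •
      ∫ y : EuclideanSpace ℝ (Fin 3), Complex.ofReal (g (x - y)) * f y)
    (q₁ q₂ : ℝ → Lp ℂ 2 (volume : Measure (EuclideanSpace ℝ (Fin 3))) → ℂ)
    (hq₁ : ∀ R f, q₁ R f =
      (Complex.ofReal (α₂ + Real.sqrt lam) * uf f x₁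
        - Complex.ofReal (δ R) * uf f (x₁ + R • e)) / Complex.ofReal (D R))
    (hq₂ : ∀ R f, q₂ R f =
      (Complex.ofReal (α₁ + Real.sqrt lam) * uf f (x₁ + R • e)
        - Complex.ofReal (δ R) * uf f x₁) / Complex.ofReal (D R)) :
    (∃ R₀ > 0, ∀ R, 0 < R → R < R₀ → D R ≠ 0) ∧
    Tendsto (fun R : ℝ =>
        ⨆ f : {f : Lp ℂ 2 (volume : Measure (EuclideanSpace ℝ (Fin 3))) // ‖f‖ ≤ 1},
          eLpNorm (fun x : EuclideanSpace ℝ (Fin 3) =>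
            q₁ R f.1 * Complex.ofReal (g (x - x₁))
              + q₂ R f.1 * Complex.ofReal (g (x - (x₁ + R • e)))
              - uf f.1 x₁ / Complex.ofReal (α + Real.sqrt lam)
                  * Complex.ofReal (g (x - x₁))) 2 volume)
      (𝓝[>] 0) (𝓝 0) := by
  set s := Real.sqrt lam with hs_def
  have hs : 0 < s := Real.sqrt_pos.mpr hlam
  have hδl : Tendsto δ (𝓝[>] 0) (𝓝 s) :=
    (tendsto_delta s θ hθ0 hθ).congr (fun R => (hδ R).symm)
  have hL : (α₁ + s) * (α₂ + s) - s ^ 2 = (α₁ + α₂) * (α + s) := by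
    rw [hα]; field_simp; ring
  have hLne : (α₁ + α₂) * (α + s) ≠ 0 := mul_ne_zero hsum hden
  have hDl : Tendsto D (𝓝[>] 0) (𝓝 ((α₁ + α₂) * (α + s))) := by
    rw [← hL]
    exact (tendsto_const_nhds.sub (hδl.pow 2)).congr (fun R => (hD R).symm)
  constructor
  · have hev := hDl.eventually_ne hLne
    rw [eventually_nhdsWithin_iff, Metric.eventually_nhds_iff] at hev
    obtain ⟨r, hr, h⟩ := hev
    refine ⟨r, hr, fun R h0 h1 => h ?_ h0⟩
    rw [Real.dist_eq, sub_zero, abs_of_pos h0]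
    exact h1
  have hg0 : MemLp (fun x => Complex.ofReal (g x)) 2
      (volume : Measure (EuclideanSpace ℝ (Fin 3))) := by
    simpa only [hg] using memLp_g s hs
  have hga : ∀ a, MemLp (fun x => Complex.ofReal (g (x - a))) 2
      (volume : Measure (EuclideanSpace ℝ (Fin 3))) := fun a =>
    hg0.comp_measurePreserving (measurePreserving_sub_right volume a)
  set G : EuclideanSpace ℝ (Fin 3) → Lp ℂ 2 (volume : Measure (EuclideanSpace ℝ (Fin 3))) :=
    fun a => (hga a).toLp _ with hG
  have hGv : ∀ a : EuclideanSpace ℝ (Fin 3), DomAddAct.mk (-a) +ᵥ G 0 = G a := by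
    intro a
    simp only [hG, DomAddAct.mk_vadd_toLp]
    congr 1
    funext x
    simp [sub_eq_neg_add]
  have hGn : ∀ a, ‖G a‖ = ‖G 0‖ := fun a => by
    rw [← hGv a, DomAddAct.norm_vadd_Lp]
  have hGc : Continuous G := by
    have : G = fun a : EuclideanSpace ℝ (Fin 3) => DomAddAct.mk (-a) +ᵥ G 0 := funext fun a => (hGv a).symm
    rw [this]
    have : Fact ((2 : ENNReal) ≠ ⊤) := ⟨by simp⟩
    have h1 : Continuous (fun a : EuclideanSpace ℝ (Fin 3) => DomAddAct.mk (-a)) :=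
      DomAddAct.continuous_mk.comp continuous_neg
    exact h1.vadd continuous_const
  set k : ℝ := 1 / (4 * Real.pi) with hk
  have hk0 : 0 ≤ k := by positivity
  have hu : ∀ f a, uf f a = (k : ℂ) * inner ℂ (G a) f := by
    intro f a
    rw [huf, Complex.real_smul, L2.inner_def]
    congr 1
    apply integral_congr_ae
    filter_upwards [(hga a).coeFn_toLp] with y hy
    simp only [hG]
    rw [hy, RCLike.inner_apply]
    have : g (a - y) = g (y - a) := by rw [hg, hg, norm_sub_rev]
    simp [this, mul_comm]
  set A := ‖G 0‖ with hA
  set η : ℝ → ℝ := fun R => ‖G (x₁ + R • e) - G x₁‖ with hη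
  have hηl : Tendsto η (𝓝[>] 0) (𝓝 0) := by
    have : Continuous η := by
      simp only [hη]
      fun_prop
    have h := (this.tendsto 0).mono_left (nhdsWithin_le_nhds (s := Set.Ioi 0))
    simpa [hη] using h
  have hu1 : ∀ f : Lp ℂ 2 (volume : Measure (EuclideanSpace ℝ (Fin 3))), ‖f‖ ≤ 1 →
      ∀ a, ‖uf f a‖ ≤ k * A := by
    intro f hf a
    rw [hu, norm_mul, Complex.norm_real, Real.norm_of_nonneg hk0]
    gcongr
    calc _ ≤ ‖G a‖ * ‖f‖ := norm_inner_le_norm _ _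
      _ ≤ ‖G a‖ * 1 := by gcongr
      _ = A := by rw [mul_one, hGn]
  have hu2 : ∀ f : Lp ℂ 2 (volume : Measure (EuclideanSpace ℝ (Fin 3))), ‖f‖ ≤ 1 →
      ∀ R, ‖uf f (x₁ + R • e) - uf f x₁‖ ≤ k * η R := by
    intro f hf R
    rw [hu, hu, ← mul_sub, ← inner_sub_left, norm_mul, Complex.norm_real,
      Real.norm_of_nonneg hk0]
    gcongr
    calc _ ≤ ‖G (x₁ + R • e) - G x₁‖ * ‖f‖ := norm_inner_le_norm _ _
      _ ≤ ‖G (x₁ + R • e) - G x₁‖ * 1 := by gcongr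
      _ = η R := by rw [mul_one]
  set c : ℝ → ℝ := fun R => (α₁ + α₂ + 2 * s - 2 * δ R) / D R - 1 / (α + s) with hc
  set b : ℝ → ℝ := fun R => (α₁ + s - δ R) / D R with hb
  set a : ℝ → ℝ := fun R => (α₁ + s) / D R with ha
  set d : ℝ → ℝ := fun R => δ R / D R with hd
  have hcl : Tendsto c (𝓝[>] 0) (𝓝 0) := by
    have h := (((tendsto_const_nhds (x := α₁ + α₂ + 2 * s)).sub
      (hδl.const_mul 2)).div hDl hLne).sub (tendsto_const_nhds (x := 1 / (α + s)))
    have h0 : (α₁ + α₂ + 2 * s - 2 * s) / ((α₁ + α₂) * (α + s)) - 1 / (α + s) = 0 := by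
      rw [add_sub_cancel_right]
      field_simp
      ring
    rw [h0] at h
    exact h
  have hbl := ((tendsto_const_nhds (x := α₁ + s)).sub hδl).div hDl hLne
  have hal := (tendsto_const_nhds (x := α₁ + s)).div hDl hLne
  have hdl := hδl.div hDl hLne
  set B : ℝ → ℝ := fun R => (|c R| * (k * A) + |b R| * (k * η R)) * A
    + (|a R| * (k * A) + |d R| * (k * A)) * η R with hB
  have hBl : Tendsto B (𝓝[>] 0) (𝓝 0) := by
    have h := (((hcl.abs.mul_const (k * A)).add (hbl.abs.mul (hηl.const_mul k))).mul_const A).add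
      (((hal.abs.mul_const (k * A)).add (hdl.abs.mul_const (k * A))).mul hηl)
    simpa using h
  have hBl' : Tendsto (fun R => ENNReal.ofReal (B R)) (𝓝[>] 0) (𝓝 0) := by
    simpa using ENNReal.tendsto_ofReal hBl
  refine tendsto_of_tendsto_of_tendsto_of_le_of_le tendsto_const_nhds hBl'
    (fun R => zero_le) (fun R => ?_)
  refine iSup_le ?_
  rintro ⟨f, hf⟩
  simp only
  set V : Lp ℂ 2 (volume : Measure (EuclideanSpace ℝ (Fin 3))) :=
    q₁ R f • G x₁ + q₂ R f • G (x₁ + R • e) - (uf f x₁ / Complex.ofReal (α + s)) • G x₁ with hV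
  have hVe : eLpNorm (fun x : EuclideanSpace ℝ (Fin 3) =>
            q₁ R f * Complex.ofReal (g (x - x₁))
              + q₂ R f * Complex.ofReal (g (x - (x₁ + R • e)))
              - uf f x₁ / Complex.ofReal (α + s)
                  * Complex.ofReal (g (x - x₁))) 2 volume = ENNReal.ofReal ‖V‖ := by
    rw [Lp.norm_def, ENNReal.ofReal_toReal (Lp.eLpNorm_ne_top V)]
    apply eLpNorm_congr_ae
    have e1 := Lp.coeFn_sub (q₁ R f • G x₁ + q₂ R f • G (x₁ + R • e))
      ((uf f x₁ / Complex.ofReal (α + s)) • G x₁)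
    have e2 := Lp.coeFn_add (q₁ R f • G x₁) (q₂ R f • G (x₁ + R • e))
    have e3 := Lp.coeFn_smul (q₁ R f) (G x₁)
    have e4 := Lp.coeFn_smul (q₂ R f) (G (x₁ + R • e))
    have e5 := Lp.coeFn_smul (uf f x₁ / Complex.ofReal (α + s)) (G x₁)
    filter_upwards [e1, e2, e3, e4, e5, (hga x₁).coeFn_toLp, (hga (x₁ + R • e)).coeFn_toLp]
      with x h1 h2 h3 h4 h5 h6 h7
    rw [hV, h1, Pi.sub_apply, h2, Pi.add_apply, h3, h4, h5]
    simp only [Pi.smul_apply, smul_eq_mul, hG]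
    rw [h6, h7]
  rw [hVe]
  apply ENNReal.ofReal_le_ofReal
  have hV2 : V = ((c R : ℂ) * uf f x₁ + (b R : ℂ) * (uf f (x₁ + R • e) - uf f x₁)) • G x₁
      + ((a R : ℂ) * uf f (x₁ + R • e) - (d R : ℂ) * uf f x₁) • (G (x₁ + R • e) - G x₁) := by
    have e2 : q₂ R f = (a R : ℂ) * uf f (x₁ + R • e) - (d R : ℂ) * uf f x₁ := by
      rw [hq₂]; simp only [ha, hd]; push_cast; ring
    have e1 : q₁ R f + q₂ R f - uf f x₁ / Complex.ofReal (α + s)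
        = (c R : ℂ) * uf f x₁ + (b R : ℂ) * (uf f (x₁ + R • e) - uf f x₁) := by
      rw [hq₁, hq₂]; simp only [hc, hb]; push_cast; ring
    rw [← e1, ← e2, hV]
    module
  rw [hV2]
  have n1 := hu1 f hf x₁
  have n2 := hu1 f hf (x₁ + R • e)
  have n3 := hu2 f hf R
  calc _ ≤ (‖(c R : ℂ)‖ * ‖uf f x₁‖ + ‖(b R : ℂ)‖ * ‖uf f (x₁ + R • e) - uf f x₁‖) * ‖G x₁‖
        + (‖(a R : ℂ)‖ * ‖uf f (x₁ + R • e)‖ + ‖(d R : ℂ)‖ * ‖uf f x₁‖)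
          * ‖G (x₁ + R • e) - G x₁‖ := by
        refine (norm_add_le _ _).trans ?_
        rw [norm_smul, norm_smul]
        gcongr
        · refine (norm_add_le _ _).trans ?_
          rw [norm_mul, norm_mul]
        · refine (norm_sub_le _ _).trans ?_
          rw [norm_mul, norm_mul]
    _ ≤ B R := by
        have hA0 : 0 ≤ A := norm_nonneg _
        have hη0 : 0 ≤ η R := norm_nonneg _
        have hηR : ‖G (x₁ + R • e) - G x₁‖ = η R := rfl
        rw [hGn x₁, hηR, Complex.norm_real, Complex.norm_real, Complex.norm_real,
          Complex.norm_real]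
        exact add_le_add
          (mul_le_mul_of_nonneg_right (add_le_add
            (mul_le_mul_of_nonneg_left n1 (abs_nonneg _))
            (mul_le_mul_of_nonneg_left n3 (abs_nonneg _))) hA0)
          (mul_le_mul_of_nonneg_right (add_le_add
            (mul_le_mul_of_nonneg_left n2 (abs_nonneg _))
            (mul_le_mul_of_nonneg_left n1 (abs_nonneg _))) hη0)
end

section
/- Fix λ > 0, a point x₁ ∈ ℝ³, a unit vector e ∈ ℝ³, and arbitrary real numbers α₁, α₂. For R > 0 put x₂(R) = x₁ + R e, δ₀(R) = −e^{−√λ R}/R (the case θ ≡ 0), and D(R) = (α₁+√λ)(α₂+√λ) − δ₀(R)². For f ∈ L²(ℝ³;ℂ) define u_f(x) = (1/(4π)) ∫_{ℝ³} g^λ(x−y) f(y) dy, and, whenever D(R) ≠ 0, q₁(R,f) = ((α₂+√λ) u_f(x₁) − δ₀(R) u_f(x₂(R)))/D(R) and q₂(R,f) = ((α₁+√λ) u_f(x₂(R)) − δ₀(R) u_f(x₁))/D(R). Then there exists R₀ > 0 with D(R) ≠ 0 for all 0 < R < R₀, and lim_{R→0⁺} sup_{‖f‖_{L²} ≤ 1}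 ‖ q₁(R,f) g^λ(·−x₁) + q₂(R,f) g^λ(·−x₂(R)) ‖_{L²(ℝ³)} = 0. -/
open MeasureTheory Filter Topology

abbrev E3 := EuclideanSpace ℝ (Fin 3)

lemma aux_memLp (s : ℝ) (hs : 0 < s) :
    MemLp (fun x : E3 => ((Real.exp (-s * ‖x‖) / ‖x‖ : ℝ) : ℂ)) 2 volume := by
  have hm : Measurable (fun x : E3 => ((Real.exp (-s * ‖x‖) / ‖x‖ : ℝ) : ℂ)) := by fun_prop
  rw [memLp_two_iff_integrable_sq_norm hm.aestronglyMeasurable]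
  have h := (integrable_fun_norm_addHaar (volume : Measure E3)
    (f := fun r : ℝ => (Real.exp (-s * r) / r) ^ 2)).2 ?_
  · simpa only [Complex.norm_real, Real.norm_eq_abs, sq_abs] using h
  · have h2 : IntegrableOn (fun x : ℝ => Real.exp (-(2 * s) * x)) (Set.Ioi 0) :=
      exp_neg_integrableOn_Ioi 0 (by positivity)
    refine h2.congr_fun ?_ measurableSet_Ioi
    intro y hy
    have hy' : (0:ℝ) < y := hy
    have : Real.exp (-(2 * s) * y) = Real.exp (-s * y) ^ 2 := by
      rw [← Real.exp_nat_mul]; congr 1; push_cast; ring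
    simp only [finrank_euclideanSpace, Fintype.card_fin, smul_eq_mul, this]
    norm_num
    field_simp

lemma aux_holder (G : E3 → ℂ) (hG : MemLp G 2 volume) (f : Lp ℂ 2 (volume : Measure E3))
    (hf : ‖f‖ ≤ 1) (x : E3) :
    ‖∫ y, G (x - y) * f y‖ ≤ (eLpNorm G 2 volume).toReal := by
  have hmp := Measure.measurePreserving_sub_left (volume : Measure E3) x
  have hGx : MemLp (fun y => G (x - y)) 2 volume := hG.comp_measurePreserving hmp
  have hN : eLpNorm (fun y => G (x - y)) 2 volume = eLpNorm G 2 volume :=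
    eLpNorm_comp_measurePreserving hG.1 hmp
  have hf1 : eLpNorm f 2 volume ≤ 1 := by
    rw [← Lp.enorm_def, ← ofReal_norm]
    exact ENNReal.ofReal_le_one.2 hf
  have h1 : ‖∫ y, G (x - y) * f y‖ₑ ≤ eLpNorm G 2 volume := by
    calc _ ≤ ∫⁻ y, ‖G (x - y) * f y‖ₑ := enorm_integral_le_lintegral_enorm _
      _ = eLpNorm ((fun y => G (x - y)) • (f : E3 → ℂ)) 1 volume := by
        rw [eLpNorm_one_eq_lintegral_enorm]; rfl
      _ ≤ eLpNorm (fun y => G (x - y)) 2 volume * eLpNorm f 2 volume :=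
        eLpNorm_smul_le_mul_eLpNorm (Lp.aestronglyMeasurable f) hGx.1
      _ ≤ eLpNorm G 2 volume * 1 := by rw [hN]; gcongr
      _ = _ := mul_one _
  rw [← toReal_enorm]
  exact ENNReal.toReal_mono hG.2.ne h1

lemma aux_shift (G : E3 → ℂ) (hG : MemLp G 2 volume) (z : E3) :
    MemLp (fun x => G (x - z)) 2 volume :=
  hG.comp_measurePreserving (measurePreserving_sub_right volume z)

lemma aux_key (G : E3 → ℂ) (hG : MemLp G 2 volume) (c : ℂ) (z : E3) :
    eLpNorm (fun x => c * G (x - z)) 2 volume = ‖c‖ₑ * eLpNorm G 2 volume := by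
  have h : eLpNorm (fun x => G (x - z)) 2 volume = eLpNorm G 2 volume :=
    eLpNorm_comp_measurePreserving hG.1 (measurePreserving_sub_right volume z)
  rw [← h]
  exact eLpNorm_const_smul c (fun x => G (x - z)) 2 volume

lemma aux_q (a d D K : ℝ) (u v : ℂ) (hu : ‖u‖ ≤ K) (hv : ‖v‖ ≤ K) :
    ‖((a:ℂ) * u - (d:ℂ) * v) / (D:ℂ)‖ ≤ (|a| + |d|) * K / |D| := by
  rw [norm_div, Complex.norm_real, Real.norm_eq_abs]
  gcongr
  calc _ ≤ ‖(a:ℂ) * u‖ + ‖(d:ℂ) * v‖ := norm_sub_le _ _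
    _ = |a| * ‖u‖ + |d| * ‖v‖ := by simp
    _ ≤ |a| * K + |d| * K := by gcongr
    _ = _ := by ring

/-- Ultraviolet pathology of standard local point interactions (`θ ≡ 0`): as the two
centers `x₁` and `x₂(R) = x₁ + R e` merge, the singular part of the resolvent vanishes
uniformly over `‖f‖_{L²} ≤ 1`, i.e. the point interactions disappear in the limit. Here
`δ₀(R) = −e^{−√λ R}/R` and `D(R) = (α₁+√λ)(α₂+√λ) − δ₀(R)²`. -/
theorem stmt_19 (lam : ℝ) (hlam : 0 < lam)
    (x₁ e : EuclideanSpace ℝ (Fin 3)) (he : ‖e‖ = 1)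
    (α₁ α₂ : ℝ)
    (g : EuclideanSpace ℝ (Fin 3) → ℝ)
    (hg : ∀ x, g x = Real.exp (-Real.sqrt lam * ‖x‖) / ‖x‖)
    (δ₀ D : ℝ → ℝ)
    (hδ₀ : ∀ R, δ₀ R = -Real.exp (-Real.sqrt lam * R) / R)
    (hD : ∀ R, D R = (α₁ + Real.sqrt lam) * (α₂ + Real.sqrt lam) - δ₀ R ^ 2)
    (uf : Lp ℂ 2 (volume : Measure (EuclideanSpace ℝ (Fin 3))) →
      EuclideanSpace ℝ (Fin 3) → ℂ)
    (huf : ∀ f x, uf f x = (1 / (4 * Real.pi)) •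
      ∫ y : EuclideanSpace ℝ (Fin 3), Complex.ofReal (g (x - y)) * f y)
    (q₁ q₂ : ℝ → Lp ℂ 2 (volume : Measure (EuclideanSpace ℝ (Fin 3))) → ℂ)
    (hq₁ : ∀ R f, q₁ R f =
      (Complex.ofReal (α₂ + Real.sqrt lam) * uf f x₁
        - Complex.ofReal (δ₀ R) * uf f (x₁ + R • e)) / Complex.ofReal (D R))
    (hq₂ : ∀ R f, q₂ R f =
      (Complex.ofReal (α₁ + Real.sqrt lam) * uf f (x₁ + R • e)
        - Complex.ofReal (δ₀ R) * uf f x₁) / Complex.ofReal (D R)) :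
    (∃ R₀ > 0, ∀ R, 0 < R → R < R₀ → D R ≠ 0) ∧
    Tendsto (fun R : ℝ =>
        ⨆ f : {f : Lp ℂ 2 (volume : Measure (EuclideanSpace ℝ (Fin 3))) // ‖f‖ ≤ 1},
          eLpNorm (fun x : EuclideanSpace ℝ (Fin 3) =>
            q₁ R f.1 * Complex.ofReal (g (x - x₁))
              + q₂ R f.1 * Complex.ofReal (g (x - (x₁ + R • e)))) 2 volume)
      (𝓝[>] 0) (𝓝 0) := by
  set s := Real.sqrt lam with hs
  have hs0 : 0 < s := Real.sqrt_pos.2 hlam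
  have hgL : MemLp (fun x => (g x : ℂ)) 2 volume := by
    simp only [hg]; exact aux_memLp s hs0
  set N := eLpNorm (fun x => (g x : ℂ)) 2 volume with hN
  have hNtop : N ≠ ⊤ := hgL.2.ne
  set K : ℝ := (1 / (4 * Real.pi)) * N.toReal with hK
  have hub : ∀ f : Lp ℂ 2 (volume : Measure (EuclideanSpace ℝ (Fin 3))), ‖f‖ ≤ 1 →
      ∀ x, ‖uf f x‖ ≤ K := by
    intro f hf x
    rw [huf, norm_smul, Real.norm_of_nonneg (by positivity)]
    exact mul_le_mul_of_nonneg_left (aux_holder _ hgL f hf x) (by positivity)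
  set a := α₁ + s
  set b := α₂ + s
  let r : ℝ → ℝ := fun R => R * Real.exp (s * R)
  have hδr : ∀ R, δ₀ R = -(r R)⁻¹ := by
    intro R
    rw [hδ₀, neg_mul, Real.exp_neg, mul_inv]
    ring
  have hrc : Continuous r := by fun_prop
  have hr0 : r 0 = 0 := by simp [r]
  have hrpos : ∀ R, 0 < R → 0 < r R := fun R h => by positivity
  have hDr : ∀ R, 0 < R → D R = (a * b * r R ^ 2 - 1) / r R ^ 2 := by
    intro R h
    have := (hrpos R h).ne'
    rw [hD, hδr]
    field_simp
  constructor
  · have hc : ContinuousAt (fun R => a * b * r R ^ 2 - 1) 0 := by fun_prop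
    have hev := hc.eventually_ne (y := 0) (by simp [hr0])
    obtain ⟨ε, hε, h⟩ := Metric.eventually_nhds_iff.1 hev
    refine ⟨ε, hε, fun R h0 h1 => ?_⟩
    rw [hDr R h0]
    have h2 : dist R 0 < ε := by rw [Real.dist_eq, sub_zero, abs_of_pos h0]; exact h1
    exact div_ne_zero (h h2) (pow_ne_zero _ (hrpos R h0).ne')
  · let B : ℝ → ℝ := fun R => ((|b| + |a|) * r R ^ 2 + 2 * r R) * K / |a * b * r R ^ 2 - 1|
    have hB : ∀ R, 0 < R → (|b| + |δ₀ R|) * K / |D R| + (|a| + |δ₀ R|) * K / |D R| = B R := by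
      intro R h
      have h1 := hrpos R h
      rw [hDr R h, hδr, abs_neg, abs_inv, abs_of_pos h1, abs_div, abs_of_pos (pow_pos h1 2)]
      simp only [B]
      rw [← add_div, div_div_eq_mul_div]
      congr 1
      field_simp
      ring
    have hBt : Tendsto B (𝓝[>] 0) (𝓝 0) := by
      have : ContinuousAt B 0 := by
        refine ContinuousAt.div (by fun_prop) (by fun_prop) (by simp [hr0])
      have h := this.tendsto
      have h0 : B 0 = 0 := by simp [B, hr0]
      rw [h0] at h
      exact h.mono_left nhdsWithin_le_nhds
    have hlim : Tendsto (fun R => ENNReal.ofReal (B R) * N) (𝓝[>] 0) (𝓝 0) := by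
      have := ENNReal.Tendsto.mul_const (ENNReal.tendsto_ofReal hBt) (b := N) (Or.inr hNtop)
      simpa using this
    refine tendsto_of_tendsto_of_tendsto_of_le_of_le' tendsto_const_nhds hlim
      (Eventually.of_forall fun _ => zero_le) ?_
    filter_upwards [self_mem_nhdsWithin] with R hR
    refine iSup_le fun f => ?_
    have hsh := aux_shift (fun x => (g x : ℂ)) hgL
    have key : ∀ (c : ℂ) z, eLpNorm (fun x => c * (g (x - z) : ℂ)) 2 volume = ‖c‖ₑ * N :=
      aux_key (fun x => (g x : ℂ)) hgL
    have h1 := aux_q b (δ₀ R) (D R) K _ _ (hub f.1 f.2 x₁) (hub f.1 f.2 (x₁ + R • e))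
    have h2 := aux_q a (δ₀ R) (D R) K _ _ (hub f.1 f.2 (x₁ + R • e)) (hub f.1 f.2 x₁)
    rw [← hq₁] at h1
    rw [← hq₂] at h2
    refine (eLpNorm_add_le ((hsh x₁).const_mul (q₁ R f.1)).1
      ((hsh (x₁ + R • e)).const_mul (q₂ R f.1)).1 (by norm_num)).trans ?_
    rw [key, key, ← add_mul, ← hB R hR]
    gcongr
    rw [← ofReal_norm, ← ofReal_norm, ← ENNReal.ofReal_add (norm_nonneg _) (norm_nonneg _)]
    exact ENNReal.ofReal_le_ofReal (add_le_add h1 h2)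
end
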